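/- arXiv:2412.19594 — 2 statements merged into one kernel-verified Lean document; each statement's English description precedes it below -/
import Mathlib

section
/- Let φ ∈ (1/2,1) be badly approximable, and let m ∈ ℕ and F ⊆ ℕ be such that a configuration X ∈ {0,1}^ℤ belongs to G_St(φ) if and only if X contains no m consecutive 0's and no two 1's at a distance k ∈ F. Let α > 3, C > 0, and V : ℕ → [0,∞) with V(k) > 0 if and only if k ∈ F and V(k) ≤ C·k^{−α} for all k ≥ 1, and let H be the Hamiltonian with two-body terms V(j−i)·1[X(i) = X(j) = 1] for i < j and finite-range terms 1[X(i) = ⋯ = X(i+m−1) = 0]. Then for every ε > 0 the Sturmian sequence X^φ is not a ground-state configuration of the perturbed Hamiltonian H − ε·N (where N counts particles, i.e. sites with symbol 1): there exists a local excitation Y ∼ X^φ with H(Y|X^φ) − ε·Σ_{i∈ℤ}(1[Y(i)=1] − 1[X^φ(i)=1]) < 0. -/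
/-- The Sturmian sequence generated by an irrational `φ ∈ (0,1)`. -/
noncomputable def sturmian (φ : ℝ) : ℤ → Fin 2 :=
  fun n => if Int.fract ((n : ℝ) * φ) < φ then 0 else 1

/-- `G_St(φ)`: closure of the shift orbit of `X^φ` in the product topology. -/
noncomputable def GSt (φ : ℝ) : Set (ℤ → Fin 2) :=
  closure {Y | ∃ k : ℤ, Y = fun n => sturmian φ (n - k)}

/-- `φ` is badly approximable: `|φ - p/q| > c/q²` for some `c > 0` and all rationals `p/q`. -/
def BadlyApproximable (φ : ℝ) : Prop :=
  ∃ c : ℝ, 0 < c ∧ ∀ p : ℤ, ∀ q : ℕ, 0 < q → c / (q : ℝ) ^ 2 < |φ - (p : ℝ) / (q : ℝ)|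

/-- `Y` is a local excitation of `X`: they differ at finitely many sites. -/
def LocalExc (Y X : ℤ → Fin 2) : Prop := {i : ℤ | Y i ≠ X i}.Finite

/-- Indicator of two particles (`1`'s) at sites `i < j`. -/
noncomputable def pairInd (X : ℤ → Fin 2) (p : ℤ × ℤ) : ℝ :=
  if X p.1 = 1 ∧ X p.2 = 1 then 1 else 0

/-- Indicator of `m` consecutive `0`'s starting at `i`. -/
noncomputable def zeroBlockInd (m : ℕ) (X : ℤ → Fin 2) (i : ℤ) : ℝ :=
  if ∀ j : ℕ, j < m → X (i + j) = 0 then 1 else 0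

/-- Relative Hamiltonian `H(Y|X)` for the two-body interactions `V(j-i)·1[X(i)=X(j)=1]`
(for `i < j`) together with the finite-range terms `1[X(i)=⋯=X(i+m-1)=0]`. -/
noncomputable def HRel (V : ℕ → ℝ) (m : ℕ) (Y X : ℤ → Fin 2) : ℝ :=
  (∑' p : ℤ × ℤ, if p.1 < p.2 then V (p.2 - p.1).toNat * (pairInd Y p - pairInd X p) else 0)
    + ∑ᶠ i : ℤ, (zeroBlockInd m Y i - zeroBlockInd m X i)

/-- Difference of particle numbers `Σ_i (1[Y(i)=1] − 1[X(i)=1])` (a finite sum for `Y ∼ X`). -/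
noncomputable def particleDiff (Y X : ℤ → Fin 2) : ℝ :=
  ∑ᶠ i : ℤ, ((if Y i = 1 then (1 : ℝ) else 0) - (if X i = 1 then (1 : ℝ) else 0))

/-- A site carries a particle of `X^φ` iff it is of the form `⌊n / (1 - φ)⌋ + 1`. -/
lemma sturmian_eq_one_iff {φ : ℝ} (hφ0 : 0 ≤ φ) (hφ2 : φ < 1) (i : ℤ) :
    sturmian φ i = 1 ↔ ∃ n : ℤ, ⌊(n : ℝ) * (1 - φ)⁻¹⌋ + 1 = i := by
  have hγ : 0 < 1 - φ := by linarith
  have key : ∀ n : ℤ, ⌊(n : ℝ) * (1 - φ)⁻¹⌋ + 1 = i ↔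
      ((i : ℝ) - 1) * (1 - φ) ≤ n ∧ (n : ℝ) < i * (1 - φ) := by
    intro n
    rw [← eq_sub_iff_add_eq, Int.floor_eq_iff, ← div_eq_mul_inv, le_div_iff₀ hγ, div_lt_iff₀ hγ]
    push_cast
    simp
  have h1 : sturmian φ i = 1 ↔ φ ≤ Int.fract ((i : ℝ) * φ) := by
    unfold sturmian
    split_ifs with h
    · simp [h]
    · simpa using h
  rw [h1]
  constructor
  · intro h
    refine ⟨i - ⌊(i : ℝ) * φ⌋ - 1, (key _).2 ?_⟩
    have h2 := Int.fract_lt_one ((i : ℝ) * φ)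
    rw [Int.fract] at h h2
    push_cast
    constructor <;> nlinarith
  · rintro ⟨n, hn⟩
    obtain ⟨h2, h3⟩ := (key n).1 hn
    have : ⌊(i : ℝ) * φ⌋ = i - n - 1 := by
      rw [Int.floor_eq_iff]
      push_cast
      constructor <;> nlinarith
    rw [Int.fract, this]
    push_cast
    nlinarith

lemma sturmian_mem_GSt (φ : ℝ) : sturmian φ ∈ GSt φ :=
  subset_closure ⟨0, by simp⟩

/-- Distances `d` with `‖dφ‖ < 1 - φ` occur between particles of `X^φ`. -/
lemma exists_sturmian_pair {φ : ℝ} (hφ : Irrational φ) (hφ0 : 0 < φ) {d k : ℤ}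
    (h : |(k : ℝ) - d * (1 - φ)| < 1 - φ) :
    ∃ i : ℤ, sturmian φ i = 1 ∧ sturmian φ (i + d) = 1 := by
  have hd : Dense (AddSubgroup.closure {φ, 1} : Set ℝ) :=
    dense_addSubgroupClosure_pair_iff.2 (by simpa using hφ)
  obtain ⟨h1, h2⟩ := abs_lt.1 h
  set s : ℝ := (k : ℝ) - d * (1 - φ) with hs
  have hlt : max φ (φ - s) < min 1 (1 - s) := by
    rw [max_lt_iff, lt_min_iff, lt_min_iff]
    refine ⟨⟨?_, ?_⟩, ?_, ?_⟩ <;> linarith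
  obtain ⟨t, htmem, ht⟩ := hd.exists_between hlt
  obtain ⟨i, p, hip⟩ := AddSubgroup.mem_closure_pair.1 htmem
  obtain ⟨ht1, ht2⟩ := ht
  rw [max_lt_iff] at ht1
  rw [lt_min_iff] at ht2
  simp only [zsmul_eq_mul, mul_one] at hip
  have e1 : Int.fract ((i : ℝ) * φ) = t := by
    rw [Int.fract_eq_iff]
    exact ⟨by linarith, by linarith, -p, by push_cast; linarith⟩
  have e2 : Int.fract (((i + d : ℤ) : ℝ) * φ) = t + s := by
    rw [Int.fract_eq_iff]
    refine ⟨by linarith, by linarith, d - p - k, ?_⟩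
    push_cast
    rw [hs, ← hip]
    ring
  refine ⟨i, ?_, ?_⟩
  · unfold sturmian
    rw [e1, if_neg (by linarith)]
  · unfold sturmian
    rw [e2, if_neg (by linarith)]

/-- `X^φ` is zero on the `⌊1 / (1 - φ)⌋` sites ending at the origin. -/
lemma sturmian_neg_eq_zero {φ : ℝ} (hφ : Irrational φ) (hφ2 : φ < 1) {j : ℤ}
    (hj0 : 0 ≤ j) (hj : j < ⌊(1 - φ)⁻¹⌋) : sturmian φ (-j) = 0 := by
  have hγ : 0 < 1 - φ := by linarith
  have hirr : Irrational (1 - φ)⁻¹ := by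
    simpa using (hφ.ratCast_sub 1).inv
  have h1 : ((j : ℝ) + 1) < (1 - φ)⁻¹ := by
    have h2 : ((j + 1 : ℤ) : ℝ) ≤ (1 - φ)⁻¹ := Int.le_floor.1 hj
    have h3 := hirr.ne_int (j + 1)
    push_cast at h2 h3
    exact lt_of_le_of_ne h2 (Ne.symm h3)
  have h4 : ((j : ℝ) + 1) * (1 - φ) < 1 := by
    rwa [← lt_div_iff₀ hγ, one_div]
  have hj' : (0 : ℝ) ≤ j := by exact_mod_cast hj0
  have e : Int.fract (((-j : ℤ) : ℝ) * φ) = j * (1 - φ) := by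
    rw [Int.fract_eq_iff]
    refine ⟨by positivity, by nlinarith, -j, ?_⟩
    push_cast
    ring
  unfold sturmian
  rw [e, if_pos (by nlinarith)]

/-- Interpolation between the labellings `n` (for `n ≤ 0`) and `n - 1` (for `n ≥ N`). -/
noncomputable def labelShift (N : ℕ) (n : ℤ) : ℝ := n - max 0 (min 1 ((n : ℝ) / N))

/-- Particle positions with labels compressed by `labelShift`. -/
noncomputable def excitedPos (β : ℝ) (N : ℕ) (n : ℤ) : ℤ := ⌊labelShift N n * β⌋ + 1

/-- The configuration whose particles are at the sites `excitedPos β N n`. -/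
noncomputable def excitedConfig (β : ℝ) (N : ℕ) (i : ℤ) : Fin 2 :=
  open Classical in if ∃ n, excitedPos β N n = i then 1 else 0

lemma excitedConfig_eq_one_iff {β : ℝ} {N : ℕ} {i : ℤ} :
    excitedConfig β N i = 1 ↔ ∃ n, excitedPos β N n = i := by
  unfold excitedConfig
  split_ifs with h <;> simp [h]

lemma labelShift_of_nonpos (N : ℕ) {n : ℤ} (hn : n ≤ 0) : labelShift N n = n := by
  have hn' : (n : ℝ) ≤ 0 := by exact_mod_cast hn
  have : (n : ℝ) / N ≤ 0 := div_nonpos_of_nonpos_of_nonneg hn' (Nat.cast_nonneg N)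
  unfold labelShift
  rw [min_eq_right (by linarith), max_eq_left this, sub_zero]

lemma labelShift_of_ge {N : ℕ} (hN : 0 < N) {n : ℤ} (hn : N ≤ n) :
    labelShift N n = n - 1 := by
  have hN' : (0 : ℝ) < N := by exact_mod_cast hN
  have hn' : (N : ℝ) ≤ n := by exact_mod_cast hn
  have : 1 ≤ (n : ℝ) / N := (one_le_div hN').2 hn'
  unfold labelShift
  rw [min_eq_left this, max_eq_right zero_le_one]

lemma labelShift_sub_le (N : ℕ) {a b : ℤ} (hab : a ≤ b) :
    labelShift N b - labelShift N a ≤ b - a := by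
  have hab' : (a : ℝ) ≤ b := by exact_mod_cast hab
  have : max 0 (min 1 ((a : ℝ) / N)) ≤ max 0 (min 1 ((b : ℝ) / N)) := by gcongr
  unfold labelShift
  linarith

lemma le_labelShift_sub (N : ℕ) {a b : ℤ} (hab : a ≤ b) :
    ((b : ℝ) - a) - ((b : ℝ) - a) / N ≤ labelShift N b - labelShift N a := by
  have hab' : (a : ℝ) / N ≤ b / N := by gcongr
  have : max 0 (min 1 ((b : ℝ) / N)) ≤ max 0 (min 1 ((a : ℝ) / N)) + ((b : ℝ) / N - a / N) := by
    refine max_le (by have := le_max_left 0 (min 1 ((a : ℝ) / N)); linarith) ?_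
    rcases le_total 1 ((a : ℝ) / N) with h | h
    · have := le_max_right 0 (min 1 ((a : ℝ) / N))
      rw [min_eq_left h] at this ⊢
      have := min_le_left 1 ((b : ℝ) / N)
      linarith
    · have := le_max_right 0 (min 1 ((a : ℝ) / N))
      rw [min_eq_right h] at this ⊢
      have := min_le_right 1 ((b : ℝ) / N)
      linarith
  unfold labelShift
  rw [sub_div]
  linarith

lemma excitedPos_strictMono {β : ℝ} (hβ : 2 ≤ β) {N : ℕ} (hN : 2 ≤ N) :
    StrictMono (excitedPos β N) := by
  refine strictMono_int_of_lt_succ fun n => ?_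
  have h := le_labelShift_sub N (show n ≤ n + 1 by omega)
  have hN' : (2 : ℝ) ≤ N := by exact_mod_cast hN
  have h2 : (1 : ℝ) / N ≤ 1 / 2 := by gcongr
  push_cast at h
  rw [add_sub_cancel_left] at h
  have h3 : labelShift N n * β + 1 ≤ labelShift N (n + 1) * β := by nlinarith
  have h4 : ⌊labelShift N n * β⌋ + 1 ≤ ⌊labelShift N (n + 1) * β⌋ := by
    rw [← Int.floor_add_one]
    exact Int.floor_le_floor h3
  unfold excitedPos
  omega

lemma sub_le_of_strictMono {y : ℤ → ℤ} (hy : StrictMono y) {a b : ℤ} (hab : a ≤ b) :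
    b - a ≤ y b - y a := by
  induction b, hab using Int.leInduction with
  | base => simp
  | succ n hn ih =>
    have := hy (show n < n + 1 by omega)
    omega

lemma excitedPos_sub_lt {β : ℝ} (hβ : 0 ≤ β) (N : ℕ) {a b : ℤ} (hab : a ≤ b) :
    ((excitedPos β N b - excitedPos β N a : ℤ) : ℝ) < (b - a) * β + 1 := by
  have h := mul_le_mul_of_nonneg_right (labelShift_sub_le N hab) hβ
  have h1 := Int.floor_le (labelShift N b * β)
  have h2 := Int.lt_floor_add_one (labelShift N a * β)
  unfold excitedPos
  push_cast
  linarith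

lemma lt_excitedPos_sub {β : ℝ} (hβ : 0 ≤ β) (N : ℕ) {a b : ℤ} (hab : a ≤ b) :
    ((b : ℝ) - a - ((b : ℝ) - a) / N) * β - 1 <
      ((excitedPos β N b - excitedPos β N a : ℤ) : ℝ) := by
  have h := mul_le_mul_of_nonneg_right (le_labelShift_sub N hab) hβ
  have h1 := Int.floor_le (labelShift N a * β)
  have h2 := Int.lt_floor_add_one (labelShift N b * β)
  unfold excitedPos
  push_cast
  linarith

/-- At short range, badly approximable numbers force excited distances to be distances of `X^φ`. -/
lemma abs_label_sub_excitedPos_lt {φ c : ℝ} (hφ1 : 1 / 2 < φ) (hφ2 : φ < 1) (hc : 0 < c)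
    (hbad : ∀ p : ℤ, ∀ q : ℕ, 0 < q → c / (q : ℝ) ^ 2 < |φ - (p : ℝ) / (q : ℝ)|)
    {N : ℕ} (hN : 2 ≤ N) {a : ℤ} {k : ℕ} (hk : 0 < k)
    (hkN : (k : ℝ) ^ 2 * ((1 - φ)⁻¹ / c) ≤ N) :
    |((k : ℤ) : ℝ) - (excitedPos (1 - φ)⁻¹ N (a + k) - excitedPos (1 - φ)⁻¹ N a : ℤ) * (1 - φ)|
      < 1 - φ := by
  have hγ : 0 < 1 - φ := by linarith
  set β := (1 - φ)⁻¹ with hβdef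
  have hβγ : β * (1 - φ) = 1 := inv_mul_cancel₀ hγ.ne'
  have hβ : 2 ≤ β := by
    rw [hβdef, le_inv_comm₀ (by norm_num) hγ]
    linarith
  have hNR : (0 : ℝ) < N := by positivity
  have hkR : (0 : ℝ) < k := by exact_mod_cast hk
  have hle : a ≤ a + k := by omega
  have up := excitedPos_sub_lt (by linarith : 0 ≤ β) N hle
  have lo := lt_excitedPos_sub (by linarith : 0 ≤ β) N hle
  have hd := sub_le_of_strictMono (excitedPos_strictMono hβ hN) hle
  set d := excitedPos β N (a + k) - excitedPos β N a
  push_cast at up lo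
  rw [add_sub_cancel_left] at up lo
  rw [abs_lt]
  push_cast
  constructor
  · nlinarith
  · by_contra! hcon
    have hqk : ((d : ℝ) + 1) * (1 - φ) ≤ k := by linarith
    obtain ⟨q, hq⟩ := Int.eq_ofNat_of_zero_le (show 0 ≤ d + 1 by omega)
    have hq0 : 0 < q := by omega
    have hqR : (0 : ℝ) < q := by exact_mod_cast hq0
    have hqd : (q : ℝ) = d + 1 := by
      have : ((q : ℤ) : ℝ) = ((d + 1 : ℤ) : ℝ) := by rw [hq]
      push_cast at this
      exact this
    have hb := hbad (q - k) q hq0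
    have e : φ - (((q : ℤ) - (k : ℤ) : ℤ) : ℝ) / q = (k - q * (1 - φ)) / q := by
      push_cast
      field_simp
      ring
    rw [e, abs_div, abs_of_pos hqR, abs_of_nonneg (by rw [hqd]; linarith),
      lt_div_iff₀ hqR] at hb
    have hb' : c / q < k - q * (1 - φ) := by
      have : c / (q : ℝ) ^ 2 * q = c / q := by field_simp
      linarith
    have hlo : (k : ℝ) - q * (1 - φ) < k / N := by
      have := mul_lt_mul_of_pos_right lo hγ
      have e2 : (((k : ℝ) - k / N) * β - 1) * (1 - φ) = (k - k / N) - (1 - φ) := by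
        linear_combination ((k : ℝ) - k / N) * hβγ
      rw [e2] at this
      rw [hqd]
      linarith
    have hqβ : (q : ℝ) ≤ k * β := by
      rw [hqd]
      have := mul_le_mul_of_nonneg_right hqk (by linarith : 0 ≤ β)
      nlinarith
    have h1 : c / (k * β) < k / N := by
      have : c / (k * β) ≤ c / q := by gcongr
      linarith
    rw [div_lt_div_iff₀ (by positivity) hNR] at h1
    have h2 : (k : ℝ) ^ 2 * (β / c) * c = k ^ 2 * β := by field_simp
    have h3 := mul_le_mul_of_nonneg_right hkN hc.le
    nlinarith

lemma excitedPos_of_nonpos (β : ℝ) (N : ℕ) {n : ℤ} (hn : n ≤ 0) :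
    excitedPos β N n = ⌊(n : ℝ) * β⌋ + 1 := by
  rw [excitedPos, labelShift_of_nonpos N hn]

lemma excitedPos_of_ge (β : ℝ) {N : ℕ} (hN : 0 < N) {n : ℤ} (hn : N ≤ n) :
    excitedPos β N n = ⌊((n - 1 : ℤ) : ℝ) * β⌋ + 1 := by
  rw [excitedPos, labelShift_of_ge hN hn]
  push_cast
  rfl

lemma sturmianPos_strictMono {β : ℝ} (hβ : 2 ≤ β) :
    StrictMono fun n : ℤ => ⌊(n : ℝ) * β⌋ + 1 := by
  refine strictMono_int_of_lt_succ fun n => ?_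
  have h4 : ⌊(n : ℝ) * β⌋ + 1 ≤ ⌊((n + 1 : ℤ) : ℝ) * β⌋ := by
    rw [← Int.floor_add_one]
    refine Int.floor_le_floor ?_
    push_cast
    linarith
  omega

open Classical in
/-- Counting the points of a strictly increasing integer sequence in a half-open interval. -/
lemma sum_Ioc_indicator_range {z : ℤ → ℤ} (hz : StrictMono z) (a b : ℤ) :
    ∑ i ∈ Finset.Ioc (z a) (z b), (if ∃ n, z n = i then (1 : ℝ) else 0) = (b - a).toNat := by
  have : (Finset.Ioc (z a) (z b)).filter (fun i => ∃ n, z n = i) = (Finset.Ioc a b).image z := by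
    ext i
    simp only [Finset.mem_filter, Finset.mem_Ioc, Finset.mem_image]
    constructor
    · rintro ⟨⟨h1, h2⟩, n, rfl⟩
      exact ⟨n, ⟨hz.lt_iff_lt.1 h1, hz.le_iff_le.1 h2⟩, rfl⟩
    · rintro ⟨n, ⟨h1, h2⟩, rfl⟩
      exact ⟨⟨hz h1, hz.monotone h2⟩, n, rfl⟩
  rw [Finset.sum_boole, this, Finset.card_image_of_injective _ hz.injective, Int.card_Ioc]

lemma excitedConfig_eq_sturmian {φ : ℝ} (hφ1 : 1 / 2 < φ) (hφ2 : φ < 1) {N : ℕ} (hN : 2 ≤ N)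
    {i : ℤ} (hi : i ∉ Finset.Ioc (excitedPos (1 - φ)⁻¹ N 0) (excitedPos (1 - φ)⁻¹ N N)) :
    excitedConfig (1 - φ)⁻¹ N i = 1 ↔ sturmian φ i = 1 := by
  have hγ : 0 < 1 - φ := by linarith
  have hβ : 2 ≤ (1 - φ)⁻¹ := by
    rw [le_inv_comm₀ (by norm_num) hγ]
    linarith
  have hy := excitedPos_strictMono hβ hN
  have hx := sturmianPos_strictMono hβ
  have h0 := excitedPos_of_nonpos (1 - φ)⁻¹ N (le_refl 0)
  have h1 := excitedPos_of_ge (1 - φ)⁻¹ (by omega : 0 < N) (le_refl (N : ℤ))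
  rw [excitedConfig_eq_one_iff, sturmian_eq_one_iff (by linarith) hφ2]
  rw [Finset.mem_Ioc, not_and_or, not_lt, not_le] at hi
  constructor
  · rintro ⟨n, rfl⟩
    rcases hi with hi | hi
    · exact ⟨n, (excitedPos_of_nonpos _ N (hy.le_iff_le.1 hi)).symm⟩
    · exact ⟨n - 1,
        (excitedPos_of_ge _ (by omega) (hy.lt_iff_lt.1 hi).le).symm⟩
  · rintro ⟨n, rfl⟩
    rcases hi with hi | hi
    · rw [h0] at hi
      exact ⟨n, excitedPos_of_nonpos _ N (hx.le_iff_le.1 hi)⟩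
    · rw [h1] at hi
      have := hx.lt_iff_lt.1 hi
      refine ⟨n + 1, ?_⟩
      rw [excitedPos_of_ge _ (by omega) (by omega), add_sub_cancel_right]

lemma localExc_excitedConfig {φ : ℝ} (hφ1 : 1 / 2 < φ) (hφ2 : φ < 1) {N : ℕ} (hN : 2 ≤ N) :
    LocalExc (excitedConfig (1 - φ)⁻¹ N) (sturmian φ) := by
  refine (Finset.finite_toSet (Finset.Ioc (excitedPos (1 - φ)⁻¹ N 0)
    (excitedPos (1 - φ)⁻¹ N N))).subset fun i hi => ?_
  by_contra hcon
  have := excitedConfig_eq_sturmian hφ1 hφ2 hN hcon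
  apply hi
  generalize excitedConfig (1 - φ)⁻¹ N i = u at *
  generalize sturmian φ i = v at *
  fin_cases u <;> fin_cases v <;> simp_all

lemma particleDiff_excitedConfig {φ : ℝ} (hφ1 : 1 / 2 < φ) (hφ2 : φ < 1) {N : ℕ} (hN : 2 ≤ N) :
    particleDiff (excitedConfig (1 - φ)⁻¹ N) (sturmian φ) = 1 := by
  classical
  have hγ : 0 < 1 - φ := by linarith
  have hβ : 2 ≤ (1 - φ)⁻¹ := by
    rw [le_inv_comm₀ (by norm_num) hγ]
    linarith
  unfold particleDiff
  rw [finsum_eq_sum_of_support_subset (s := Finset.Ioc (excitedPos (1 - φ)⁻¹ N 0)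
    (excitedPos (1 - φ)⁻¹ N N)), Finset.sum_sub_distrib]
  · have e1 := sum_Ioc_indicator_range (excitedPos_strictMono hβ hN) 0 N
    have e2 := sum_Ioc_indicator_range (sturmianPos_strictMono hβ) 0 (N - 1)
    rw [← excitedPos_of_nonpos (1 - φ)⁻¹ N (le_refl 0),
      ← excitedPos_of_ge (1 - φ)⁻¹ (by omega : 0 < N) (le_refl (N : ℤ))] at e2
    simp only [excitedConfig_eq_one_iff, sturmian_eq_one_iff (by linarith) hφ2]
    rw [e1, e2]
    have : ((N : ℤ) - 0).toNat = ((N : ℤ) - 1 - 0).toNat + 1 := by omega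
    rw [this]
    push_cast
    ring
  · intro i hi
    by_contra hcon
    exact hi (by simp [excitedConfig_eq_sturmian hφ1 hφ2 hN hcon])

/-- If `⌊β⌋ < m`, the excited configuration has no `m` consecutive empty sites. -/
lemma excitedConfig_no_zero_block {β : ℝ} (hβ : 2 ≤ β) {N : ℕ} (hN : 2 ≤ N) {m : ℕ}
    (hm : ⌊β⌋ < m) (n : ℤ) : ¬ ∀ j : ℕ, j < m → excitedConfig β N (n + j) = 0 := by
  intro h
  have hy := excitedPos_strictMono hβ hN
  obtain ⟨a, ha, hmax⟩ : ∃ a, excitedPos β N a < n ∧ ∀ b, excitedPos β N b < n → b ≤ a := by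
    refine Int.exists_greatest_of_bdd (P := fun a => excitedPos β N a < n)
      ⟨max 0 (n - excitedPos β N 0), fun z hz => ?_⟩
      ⟨min 0 (n - 1 - excitedPos β N 0), ?_⟩
    · rcases le_total z 0 with h0 | h0
      · exact le_max_of_le_left h0
      · have := sub_le_of_strictMono hy h0
        refine le_max_of_le_right ?_
        omega
    · have := sub_le_of_strictMono hy (min_le_left 0 (n - 1 - excitedPos β N 0))
      have := min_le_right 0 (n - 1 - excitedPos β N 0)
      omega
  have h1 : n ≤ excitedPos β N (a + 1) := by
    by_contra! hcon
    have := hmax _ hcon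
    omega
  have h2 : n + m ≤ excitedPos β N (a + 1) := by
    by_contra! hcon
    have h3 := h (excitedPos β N (a + 1) - n).toNat (by omega)
    rw [show n + ((excitedPos β N (a + 1) - n).toNat : ℤ) = excitedPos β N (a + 1) by omega,
      excitedConfig_eq_one_iff.2 ⟨_, rfl⟩] at h3
    simp at h3
  have h4 := excitedPos_sub_lt (by linarith : 0 ≤ β) N (show a ≤ a + 1 by omega)
  push_cast at h4
  rw [add_sub_cancel_left, one_mul] at h4
  have h5 : excitedPos β N (a + 1) - excitedPos β N a - 1 ≤ ⌊β⌋ := by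
    rw [Int.le_floor]
    push_cast
    linarith
  omega

/-- Tail sums of `∑ M k ^ (2 - α)` are arbitrarily small. -/
lemma exists_rpow_tail_lt (α M : ℝ) {ε : ℝ} (hε : 0 < ε) :
    ∃ K : ℕ, 1 ≤ K ∧ ∑' k : ℕ, (if K ≤ k then M * (k : ℝ) ^ (2 - α) else 0) < ε := by
  have ht := tendsto_sum_nat_add fun k : ℕ => M * (k : ℝ) ^ (2 - α)
  obtain ⟨K, hK, hK1⟩ :=
    ((ht.eventually (gt_mem_nhds hε)).and (Filter.eventually_ge_atTop 1)).exists
  refine ⟨K, hK1, lt_of_eq_of_lt ?_ hK⟩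
  have hinj : Function.Injective fun k : ℕ => k + K := add_left_injective K
  rw [← hinj.tsum_eq]
  · simp
  · intro k hk
    have : K ≤ k := by
      by_contra hcon
      exact hk (if_neg hcon)
    exact ⟨k - K, by simp only; omega⟩

/-- Energy bound for a configuration whose only interacting pairs have labels at distance at
least `K` and straddle the label window `(0, N)`. -/
lemma tsum_pair_energy_le {y : ℤ → ℤ} (hy : StrictMono y) {Y : ℤ → Fin 2}
    (hY : ∀ i, Y i = 1 ↔ ∃ n, y n = i) {V : ℕ → ℝ} {α C D : ℝ} (hα : 3 < α) (hC : 0 < C)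
    (hV0 : ∀ k, 0 ≤ V k) (hVdecay : ∀ k : ℕ, 1 ≤ k → V k ≤ C * (k : ℝ) ^ (-α))
    {N K : ℕ} (hK : 1 ≤ K) (hD : 0 ≤ D) (hND : (N : ℝ) ≤ D * (K : ℝ) ^ 2)
    (hV : ∀ (a : ℤ) (k : ℕ), 0 < k → (a + k ≤ 0 ∨ N ≤ a ∨ k < K) →
      V (y (a + k) - y a).toNat = 0) :
    ∑' p : ℤ × ℤ, (if p.1 < p.2 then V (p.2 - p.1).toNat * pairInd Y p else 0) ≤
      ∑' k : ℕ, if K ≤ k then C * (D + 1) * (k : ℝ) ^ (2 - α) else 0 := by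
  classical
  set T : ℤ × ℤ → ℝ := fun p => if p.1 < p.2 then V (p.2 - p.1).toNat * pairInd Y p else 0
  have hT0 : ∀ p, 0 ≤ T p := fun p => by
    simp only [T, pairInd]
    split_ifs <;> simp [hV0]
  let e : ℕ × ℤ → ℤ × ℤ := fun q => (y q.2, y (q.2 + q.1))
  have he : Function.Injective e := by
    rintro ⟨k, a⟩ ⟨l, b⟩ h
    simp only [e, Prod.mk.injEq, hy.injective.eq_iff] at h
    ext <;> simp only <;> omega
  have hsupp : Function.support T ⊆ Set.range e := by
    rintro ⟨i, j⟩ hp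
    have hlt : i < j := by
      by_contra hcon
      exact hp (if_neg hcon)
    have hone : Y i = 1 ∧ Y j = 1 := by
      by_contra hcon
      exact hp (by simp [T, pairInd, hcon])
    obtain ⟨a, rfl⟩ := (hY i).1 hone.1
    obtain ⟨b, rfl⟩ := (hY j).1 hone.2
    have := hy.lt_iff_lt.1 hlt
    refine ⟨((b - a).toNat, a), ?_⟩
    simp only [e]
    rw [show a + ((b - a).toNat : ℤ) = b by omega]
  rw [← he.tsum_eq hsupp]
  let G : ℕ × ℤ → ℝ := fun q =>
    if K ≤ q.1 ∧ q.2 ∈ Finset.Ioo (-(q.1 : ℤ)) N then C * (q.1 : ℝ) ^ (-α) else 0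
  have hG0 : ∀ q, 0 ≤ G q := fun q => by
    simp only [G]
    split_ifs
    · positivity
    · exact le_rfl
  have hTG : ∀ q, T (e q) ≤ G q := by
    rintro ⟨k, a⟩
    have hTV : T (e (k, a)) ≤ if 0 < k then V (y (a + k) - y a).toNat else 0 := by
      simp only [T, e, pairInd, hy.lt_iff_lt, lt_add_iff_pos_right, Nat.cast_pos]
      split_ifs <;> simp [hV0]
    refine hTV.trans ?_
    rcases Nat.eq_zero_or_pos k with rfl | hk
    · simpa using hG0 _
    rw [if_pos hk]
    by_cases hG : K ≤ k ∧ a ∈ Finset.Ioo (-(k : ℤ)) N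
    · have hd := sub_le_of_strictMono hy (show a ≤ a + k by omega)
      have hkd : k ≤ (y (a + k) - y a).toNat := by omega
      have hkR : (0 : ℝ) < k := by exact_mod_cast hk
      simp only [G, if_pos hG]
      refine (hVdecay _ (by omega)).trans ?_
      gcongr C * ?_
      exact Real.rpow_le_rpow_of_nonpos hkR (by exact_mod_cast hkd) (by linarith)
    · rw [hV a k hk]
      · exact hG0 _
      · rw [Finset.mem_Ioo] at hG
        omega
  have hinner : ∀ k : ℕ, HasSum (fun a => G (k, a))
      (if K ≤ k then ((N : ℤ) - (-(k : ℤ)) - 1).toNat * (C * (k : ℝ) ^ (-α)) else 0) := by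
    intro k
    have h := hasSum_sum_of_ne_finset_zero (L := .unconditional ℤ) (f := fun a => G (k, a))
      (s := Finset.Ioo (-(k : ℤ)) N) fun a ha => if_neg fun h => ha h.2
    convert h using 1
    by_cases hk : K ≤ k
    · rw [if_pos hk, Finset.sum_congr rfl (g := fun _ => C * (k : ℝ) ^ (-α))
        fun a ha => if_pos ⟨hk, ha⟩]
      simp
    · rw [if_neg hk, Finset.sum_eq_zero fun a _ => if_neg fun h => hk h.1]
  have hle : ∀ k : ℕ, (∑' a, G (k, a)) ≤
      if K ≤ k then C * (D + 1) * (k : ℝ) ^ (2 - α) else 0 := by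
    intro k
    rw [(hinner k).tsum_eq]
    split_ifs with hk
    · have hk1 : (1 : ℝ) ≤ k := by exact_mod_cast hK.trans hk
      have hKk : (K : ℝ) ≤ k := by exact_mod_cast hk
      have hcard : ((((N : ℤ) - (-(k : ℤ)) - 1).toNat : ℕ) : ℝ) ≤ (D + 1) * (k : ℝ) ^ 2 := by
        have h1 : ((((N : ℤ) - (-(k : ℤ)) - 1).toNat : ℕ) : ℝ) ≤ (N + k : ℕ) := by
          exact_mod_cast (by omega : ((N : ℤ) - (-(k : ℤ)) - 1).toNat ≤ N + k)
        have h2 : D * (K : ℝ) ^ 2 ≤ D * (k : ℝ) ^ 2 := by gcongr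
        push_cast at h1
        nlinarith
      have hpow : (k : ℝ) ^ (2 - α) = (k : ℝ) ^ 2 * (k : ℝ) ^ (-α) := by
        rw [sub_eq_add_neg, Real.rpow_add (by linarith), Real.rpow_two]
      rw [hpow]
      calc _ ≤ (D + 1) * (k : ℝ) ^ 2 * (C * (k : ℝ) ^ (-α)) := by gcongr
        _ = _ := by ring
    · exact le_rfl
  have hbs : Summable fun k : ℕ => if K ≤ k then C * (D + 1) * (k : ℝ) ^ (2 - α) else 0 := by
    have h : Summable fun k : ℕ => C * (D + 1) * (k : ℝ) ^ (2 - α) :=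
      (Real.summable_nat_rpow.2 (by linarith)).mul_left _
    refine h.of_nonneg_of_le (fun k => ?_) fun k => ?_ <;> split_ifs <;>
      first | positivity | exact le_rfl
  have hos : Summable fun k : ℕ => ∑' a, G (k, a) :=
    hbs.of_nonneg_of_le (fun k => tsum_nonneg fun a => hG0 _) hle
  have hGs : Summable G :=
    (summable_prod_of_nonneg hG0).2 ⟨fun k => (hinner k).summable, hos⟩
  have hTs : Summable fun q => T (e q) := hGs.of_nonneg_of_le (fun q => hT0 _) hTG
  calc ∑' q, T (e q) ≤ ∑' q, G q := hTs.tsum_le_tsum hTG hGs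
    _ = ∑' k, ∑' a, G (k, a) := hGs.tsum_prod
    _ ≤ _ := hos.tsum_le_tsum hle hbs

/-- For badly approximable `φ ∈ (1/2,1)` with forbidden-pattern data `m`, `F`,
and couplings `V` supported on `F` decaying as `C·k^{−α}` with `α > 3`, the Sturmian sequence
`X^φ` is not a ground-state configuration of `H − ε·N` for any `ε > 0`: some local excitation
`Y ∼ X^φ` satisfies `H(Y|X^φ) − ε·ΣᵢΔN < 0`. -/
theorem sturmian_unstable_against_chemical_potential
    (φ : ℝ) (hφ : Irrational φ) (hφ1 : 1/2 < φ) (hφ2 : φ < 1)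
    (hbad : BadlyApproximable φ)
    (m : ℕ) (F : Set ℕ)
    (hchar : ∀ X : ℤ → Fin 2,
      X ∈ GSt φ ↔
        ((¬ ∃ n : ℤ, ∀ i : ℕ, i < m → X (n + i) = 0) ∧
         (¬ ∃ n : ℤ, ∃ k ∈ F, X n = 1 ∧ X (n + k) = 1)))
    (α : ℝ) (hα : 3 < α) (C : ℝ) (hC : 0 < C)
    (V : ℕ → ℝ) (hV0 : ∀ k, 0 ≤ V k) (hVF : ∀ k, 0 < V k ↔ k ∈ F)
    (hVdecay : ∀ k : ℕ, 1 ≤ k → V k ≤ C * (k : ℝ) ^ (-α)) :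
    ∀ ε : ℝ, 0 < ε → ∃ Y : ℤ → Fin 2, LocalExc Y (sturmian φ) ∧
      HRel V m Y (sturmian φ) - ε * particleDiff Y (sturmian φ) < 0 := by
  intro ε hε
  obtain ⟨c, hc, hbad⟩ := hbad
  have hγ : 0 < 1 - φ := by linarith
  have hβ : 2 ≤ (1 - φ)⁻¹ := by
    rw [le_inv_comm₀ (by norm_num) hγ]
    linarith
  obtain ⟨hzero, hpair⟩ := (hchar _).1 (sturmian_mem_GSt φ)
  have hVzero : ∀ k, k ∉ F → V k = 0 := fun k hk =>
    le_antisymm (not_lt.1 fun h => hk ((hVF k).1 h)) (hV0 k)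
  have hVX : ∀ i j : ℤ, i < j → sturmian φ i = 1 → sturmian φ j = 1 → V (j - i).toNat = 0 := by
    intro i j hij hi hj
    refine hVzero _ fun hF => hpair ⟨i, _, hF, hi, ?_⟩
    rwa [show i + ((j - i).toNat : ℤ) = j by omega]
  have hm : ⌊(1 - φ)⁻¹⌋ < m := by
    by_contra! hcon
    refine hzero ⟨-((m : ℤ) - 1), fun i hi => ?_⟩
    rw [show -((m : ℤ) - 1) + i = -((m : ℤ) - 1 - i) by ring]
    exact sturmian_neg_eq_zero hφ hφ2 (by omega) (by omega)
  set D : ℝ := (1 - φ)⁻¹ / c + 3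
  have hD0 : 0 ≤ (1 - φ)⁻¹ / c := by positivity
  obtain ⟨K, hK, htail⟩ := exists_rpow_tail_lt α (C * (D + 1)) hε
  have hKR : (1 : ℝ) ≤ (K : ℝ) ^ 2 := one_le_pow₀ (by exact_mod_cast hK)
  set N : ℕ := ⌈(K : ℝ) ^ 2 * ((1 - φ)⁻¹ / c)⌉₊ + 2 with hNdef
  have hN : 2 ≤ N := by omega
  have hKN : (K : ℝ) ^ 2 * ((1 - φ)⁻¹ / c) ≤ N := by
    have := Nat.le_ceil ((K : ℝ) ^ 2 * ((1 - φ)⁻¹ / c))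
    rw [hNdef]
    push_cast
    linarith
  have hND : (N : ℝ) ≤ D * (K : ℝ) ^ 2 := by
    have := Nat.ceil_lt_add_one (show 0 ≤ (K : ℝ) ^ 2 * ((1 - φ)⁻¹ / c) by positivity)
    rw [hNdef]
    push_cast
    simp only [D]
    nlinarith
  have hy := excitedPos_strictMono hβ hN
  refine ⟨excitedConfig (1 - φ)⁻¹ N, localExc_excitedConfig hφ1 hφ2 hN, ?_⟩
  rw [particleDiff_excitedConfig hφ1 hφ2 hN]
  have hblock : ∑ᶠ i : ℤ, (zeroBlockInd m (excitedConfig (1 - φ)⁻¹ N) i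
      - zeroBlockInd m (sturmian φ) i) = 0 := by
    refine finsum_eq_zero_of_forall_eq_zero fun i => ?_
    unfold zeroBlockInd
    rw [if_neg (excitedConfig_no_zero_block hβ hN hm i), if_neg fun h => hzero ⟨i, h⟩, sub_zero]
  have hpairs : (∑' p : ℤ × ℤ, if p.1 < p.2 then V (p.2 - p.1).toNat *
      (pairInd (excitedConfig (1 - φ)⁻¹ N) p - pairInd (sturmian φ) p) else 0) =
      ∑' p : ℤ × ℤ, if p.1 < p.2 then V (p.2 - p.1).toNat *
        pairInd (excitedConfig (1 - φ)⁻¹ N) p else 0 := by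
    refine tsum_congr fun p => ?_
    split_ifs with hp
    · by_cases h : sturmian φ p.1 = 1 ∧ sturmian φ p.2 = 1
      · rw [hVX _ _ hp h.1 h.2, zero_mul, zero_mul]
      · rw [pairInd.eq_def (sturmian φ), if_neg h, sub_zero]
    · rfl
  unfold HRel
  rw [hblock, hpairs, add_zero]
  have hbound := tsum_pair_energy_le hy (fun i => excitedConfig_eq_one_iff) hα hC hV0 hVdecay hK
    (by positivity : 0 ≤ D) hND (fun a k hk hcases => ?_)
  · linarith
  have hlt : excitedPos (1 - φ)⁻¹ N a < excitedPos (1 - φ)⁻¹ N (a + k) := hy (by omega)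
  have hin : ∀ b : ℤ, b ≤ 0 ∨ N ≤ b → sturmian φ (excitedPos (1 - φ)⁻¹ N b) = 1 := by
    intro b hb
    rw [sturmian_eq_one_iff (by linarith) hφ2]
    rcases hb with hb | hb
    · exact ⟨b, (excitedPos_of_nonpos _ N hb).symm⟩
    · exact ⟨b - 1, (excitedPos_of_ge _ (by omega) hb).symm⟩
  rcases hcases with h | h | h
  · exact hVX _ _ hlt (hin _ (by omega)) (hin _ (by omega))
  · exact hVX _ _ hlt (hin _ (by omega)) (hin _ (by omega))
  · have hkN : (k : ℝ) ^ 2 * ((1 - φ)⁻¹ / c) ≤ N := by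
      refine le_trans ?_ hKN
      gcongr
    obtain ⟨i, hi, hj⟩ := exists_sturmian_pair hφ (by linarith)
      (abs_label_sub_excitedPos_lt hφ1 hφ2 hc hbad hN (a := a) hk hkN)
    have := hVX _ _ (by omega) hi hj
    rwa [add_sub_cancel_left] at this
end

section
/- The Thue–Morse interactions are non-frustrated: for every X ∈ G_TM, every i ∈ ℤ and all r, p ≥ 0, (X(i)+X(i+2^r))·(X(i+(2p+1)2^r)+X(i+(2p+2)2^r)) = 0; in particular every term J(r,p)(σ_i+σ_{i+2^r})²(σ_{i+(2p+1)2^r}+σ_{i+(2p+2)2^r})² of the Thue–Morse Hamiltonian attains its minimal value 0 on every configuration in G_TM. -/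
/-- `t(n) = (−1)^{s(n)}` where `s(n)` is the sum of binary digits of `n` (Thue–Morse). -/
def tmSign (n : ℕ) : ℤ := (-1) ^ ((Nat.digits 2 n).sum)

/-- The two-sided Thue–Morse configuration in `{+1,−1}^ℤ`. -/
def XTM : ℤ → ℤ := fun n => if 0 ≤ n then tmSign n.toNat else tmSign (-n - 1).toNat

/-- `G_TM`: the closure in the product topology of the shift orbit of `X_TM`. -/
def GTM : Set (ℤ → ℤ) := closure {Y | ∃ k : ℤ, Y = fun n => XTM (n - k)}

theorem tmSign_two_mul (n : ℕ) : tmSign (2 * n) = tmSign n := by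
  rcases Nat.eq_zero_or_pos n with rfl | hn
  · rfl
  · unfold tmSign
    rw [Nat.digits_def' one_lt_two (by omega)]
    simp

theorem tmSign_two_mul_add_one (n : ℕ) : tmSign (2 * n + 1) = -tmSign n := by
  unfold tmSign
  rw [Nat.digits_def' one_lt_two (by omega), show (2 * n + 1) % 2 = 1 by omega,
    show (2 * n + 1) / 2 = n by omega]
  simp [pow_add]

/-- The two-sided sequence equal to `t` on the right half-line and to `c` times the reflection
of `t` on the left half-line. -/
def twistedThueMorse (c n : ℤ) : ℤ :=
  if 0 ≤ n then tmSign n.toNat else c * tmSign (-n - 1).toNat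

theorem XTM_eq_twistedThueMorse (n : ℤ) : XTM n = twistedThueMorse 1 n := by
  simp [XTM, twistedThueMorse]

theorem twistedThueMorse_two_mul (c n : ℤ) :
    twistedThueMorse c (2 * n) = twistedThueMorse (-c) n := by
  unfold twistedThueMorse
  by_cases h : 0 ≤ n
  · rw [if_pos h, if_pos (by omega), show (2 * n).toNat = 2 * n.toNat by omega, tmSign_two_mul]
  · rw [if_neg h, if_neg (by omega),
      show (-(2 * n) - 1).toNat = 2 * (-n - 1).toNat + 1 by omega, tmSign_two_mul_add_one]
    ring

theorem twistedThueMorse_two_mul_add_one (c n : ℤ) :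
    twistedThueMorse c (2 * n + 1) = -twistedThueMorse (-c) n := by
  unfold twistedThueMorse
  by_cases h : 0 ≤ n
  · rw [if_pos h, if_pos (by omega), show (2 * n + 1).toNat = 2 * n.toNat + 1 by omega,
      tmSign_two_mul_add_one]
  · rw [if_neg h, if_neg (by omega),
      show (-(2 * n + 1) - 1).toNat = 2 * (-n - 1).toNat by omega, tmSign_two_mul]
    ring

theorem twistedThueMorse_non_frustrated (r : ℕ) (c i p : ℤ) :
    (twistedThueMorse c i + twistedThueMorse c (i + 2 ^ r)) *
      (twistedThueMorse c (i + (2 * p + 1) * 2 ^ r) +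
        twistedThueMorse c (i + (2 * p + 2) * 2 ^ r)) = 0 := by
  induction r generalizing c i with
  | zero =>
    obtain ⟨j, rfl | rfl⟩ := Int.even_or_odd' i
    · rw [pow_zero, twistedThueMorse_two_mul, twistedThueMorse_two_mul_add_one]
      ring
    · rw [show 2 * j + 1 + (2 * p + 1) * 2 ^ 0 = 2 * (j + p + 1) by ring,
        show 2 * j + 1 + (2 * p + 2) * 2 ^ 0 = 2 * (j + p + 1) + 1 by ring,
        twistedThueMorse_two_mul c (j + p + 1), twistedThueMorse_two_mul_add_one c (j + p + 1)]
      ring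
  | succ r ih =>
    obtain ⟨j, rfl | rfl⟩ := Int.even_or_odd' i
    · have shift (a : ℤ) : 2 * j + a * 2 ^ (r + 1) = 2 * (j + a * 2 ^ r) := by ring
      have shift_one := shift 1
      rw [one_mul, one_mul] at shift_one
      simp only [shift, shift_one, twistedThueMorse_two_mul]
      exact ih (-c) j
    · have shift (a : ℤ) : 2 * j + 1 + a * 2 ^ (r + 1) = 2 * (j + a * 2 ^ r) + 1 := by ring
      have shift_one := shift 1
      rw [one_mul, one_mul] at shift_one
      simp only [shift, shift_one, twistedThueMorse_two_mul_add_one]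
      linear_combination ih (-c) j

theorem GTM_non_frustrated {X : ℤ → ℤ} (hX : X ∈ GTM) (i : ℤ) (r : ℕ) (p : ℤ) :
    (X i + X (i + 2 ^ r)) *
      (X (i + (2 * p + 1) * 2 ^ r) + X (i + (2 * p + 2) * 2 ^ r)) = 0 := by
  have closed : IsClosed {Y : ℤ → ℤ | (Y i + Y (i + 2 ^ r)) *
      (Y (i + (2 * p + 1) * 2 ^ r) + Y (i + (2 * p + 2) * 2 ^ r)) = 0} :=
    isClosed_eq (by fun_prop) continuous_const
  refine closure_minimal ?_ closed hX
  rintro _ ⟨k, rfl⟩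
  simp only [Set.mem_ofPred_eq, XTM_eq_twistedThueMorse, add_sub_right_comm]
  exact twistedThueMorse_non_frustrated r 1 (i - k) p

/-- The Thue–Morse interactions are non-frustrated: every `X ∈ G_TM`
satisfies `(X(i)+X(i+2^r))·(X(i+(2p+1)2^r)+X(i+(2p+2)2^r)) = 0` for all `i ∈ ℤ`, `r, p ≥ 0`;
in particular every term `J(r,p)(σ_i+σ_{i+2^r})²(σ_{i+(2p+1)2^r}+σ_{i+(2p+2)2^r})²` of the
Thue–Morse Hamiltonian attains its minimal value `0` on every configuration in `G_TM`. -/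
theorem thueMorse_interactions_non_frustrated :
    ∀ X ∈ GTM, ∀ i : ℤ, ∀ r p : ℕ,
      (X i + X (i + 2 ^ r)) *
        (X (i + (2 * (p : ℤ) + 1) * 2 ^ r) + X (i + (2 * (p : ℤ) + 2) * 2 ^ r)) = 0 ∧
      ∀ J : ℝ, 0 < J →
        J * ((X i + X (i + 2 ^ r) : ℤ) : ℝ) ^ 2 *
          ((X (i + (2 * (p : ℤ) + 1) * 2 ^ r) + X (i + (2 * (p : ℤ) + 2) * 2 ^ r) : ℤ) : ℝ) ^ 2
          = 0 ∧
        ∀ Y : ℤ → ℤ, (0 : ℝ) ≤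
          J * ((Y i + Y (i + 2 ^ r) : ℤ) : ℝ) ^ 2 *
            ((Y (i + (2 * (p : ℤ) + 1) * 2 ^ r) + Y (i + (2 * (p : ℤ) + 2) * 2 ^ r) : ℤ) : ℝ) ^ 2
      := by
  intro X hX i r p
  have h := GTM_non_frustrated hX i r p
  refine ⟨h, fun J hJ => ⟨?_, fun Y => by positivity⟩⟩
  rw [mul_assoc, ← mul_pow, ← Int.cast_mul, h]
  simp
end
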